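/- Let Ω ⊆ [0,1]² be a measurable set of Lebesgue measure 1/2, and let f1(x,y) = |Ω ∩ ([0,x]×[0,y])|. Then a set Ω of Lebesgue measure 1/2 minimizes the expected squared L2-discrepancy D(Ω) of the two-point jittered sampling construction among all measurable subsets of [0,1]² of measure 1/2 if and only if it maximizes the functional ∫₀¹∫₀¹ f1(x,y)·( f1(x,y) − x·y ) dx dy among all such subsets. -/

import Mathlib

open MeasureTheory Set

noncomputable section

/-- The closed unit square `[0,1]²` in `ℝ × ℝ`. -/
def unitSq : Set (ℝ × ℝ) := Icc (0:ℝ) 1 ×ˢ Icc (0:ℝ) 1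

/-- The anchored axis-parallel box `[0,x] × [0,y]`. -/
def box (x y : ℝ) : Set (ℝ × ℝ) := Icc (0:ℝ) x ×ˢ Icc (0:ℝ) y

/-- The uniform probability measure on a set `S ⊆ ℝ²`. -/
def unif (S : Set (ℝ × ℝ)) : Measure (ℝ × ℝ) := (volume S)⁻¹ • volume.restrict S

/-- The number of the two points `p1`, `p2` lying in the box `[0,x] × [0,y]`. -/
def countIn (p1 p2 : ℝ × ℝ) (x y : ℝ) : ℝ :=
  (box x y).indicator (fun _ => (1:ℝ)) p1 + (box x y).indicator (fun _ => (1:ℝ)) p2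

/-- The squared L2 discrepancy of the two-point multiset `{p1, p2}`. -/
def L2sq (p1 p2 : ℝ × ℝ) : ℝ :=
  ∫ x in (0:ℝ)..1, ∫ y in (0:ℝ)..1, |countIn p1 p2 x y / 2 - x * y| ^ 2

/-- The joint law of the jittered pair `(p1, p2)`: `p1` uniform on `Ω`,
`p2` uniform on `[0,1]² \ Ω`, independent. -/
def jitter (Ω : Set (ℝ × ℝ)) : Measure ((ℝ × ℝ) × (ℝ × ℝ)) :=
  (unif Ω).prod (unif (unitSq \ Ω))

/-- The expected squared L2 discrepancy of the two-point jittered sampling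
construction associated to `Ω`. -/
def Djit (Ω : Set (ℝ × ℝ)) : ℝ := ∫ q, L2sq q.1 q.2 ∂(jitter Ω)

/-- `f1 Ω x y` is the Lebesgue measure of `Ω ∩ ([0,x] × [0,y])`. -/
def f1 (Ω : Set (ℝ × ℝ)) (x y : ℝ) : ℝ := (volume (Ω ∩ box x y)).toReal

/-- The hypograph of `g` within the unit square. -/
def hypo (g : ℝ → ℝ) : Set (ℝ × ℝ) := {q ∈ unitSq | q.2 ≤ g q.1}

/-- `g` is an admissible partitioning function for area `p`: it is monotonically
decreasing on `[0,1]`, maps `[0,1]` into `[0,1]`, its hypograph has Lebesgue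
measure `p`, and its hypograph is symmetric about the diagonal `y = x` up to a
Lebesgue-null set. -/
def Admissible (p : ℝ) (g : ℝ → ℝ) : Prop :=
  AntitoneOn g (Icc (0:ℝ) 1) ∧ (∀ x ∈ Icc (0:ℝ) 1, g x ∈ Icc (0:ℝ) 1) ∧
  volume (hypo g) = ENNReal.ofReal p ∧
  (∀ᵐ q ∂(volume.restrict unitSq), (q ∈ hypo g ↔ q.swap ∈ hypo g))

end

/-- Mean squared deviation of the average of two independent indicators of `A` from `c`. -/
theorem integral_sq_indicator_average {α : Type*} [MeasurableSpace α] (μ ν : Measure α)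
    [IsProbabilityMeasure μ] [IsProbabilityMeasure ν] {A : Set α} (hA : MeasurableSet A) (c : ℝ) :
    ∫ q, |(A.indicator (fun _ => (1:ℝ)) q.1 + A.indicator (fun _ => (1:ℝ)) q.2) / 2 - c| ^ 2
        ∂(μ.prod ν)
      = (1 / 4 - c) * μ.real A + (1 / 4 - c) * ν.real A + μ.real A * ν.real A / 2 + c ^ 2 := by
  set I : α → ℝ := A.indicator (fun _ => (1:ℝ)) with hI
  have hIμ : Integrable I μ := (integrable_const 1).indicator hA
  have hIν : Integrable I ν := (integrable_const 1).indicator hA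
  have hsq : ∀ p, I p * I p = I p := fun p => by by_cases h : p ∈ A <;> simp [hI, h]
  have hexp : ∀ q : α × α, |(I q.1 + I q.2) / 2 - c| ^ 2
      = (1 / 4 - c) * I q.1 + (1 / 4 - c) * I q.2 + I q.1 * I q.2 / 2 + c ^ 2 := fun q => by
    rw [sq_abs]
    linear_combination (1 / 4) * hsq q.1 + (1 / 4) * hsq q.2
  have h1 : Integrable (fun q : α × α => (1 / 4 - c) * I q.1) (μ.prod ν) :=
    (hIμ.comp_fst ν).const_mul _
  have h2 : Integrable (fun q : α × α => (1 / 4 - c) * I q.2) (μ.prod ν) :=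
    (hIν.comp_snd μ).const_mul _
  have h12 : Integrable (fun q : α × α => (1 / 4 - c) * I q.1 + (1 / 4 - c) * I q.2)
      (μ.prod ν) := h1.add h2
  have h3 : Integrable (fun q : α × α => I q.1 * I q.2 / 2) (μ.prod ν) :=
    (hIμ.mul_prod hIν).div_const _
  have h123 : Integrable (fun q : α × α =>
      (1 / 4 - c) * I q.1 + (1 / 4 - c) * I q.2 + I q.1 * I q.2 / 2) (μ.prod ν) := h12.add h3
  have hμ : ∫ p, I p ∂μ = μ.real A := by simp [hI, integral_indicator hA]
  have hν : ∫ p, I p ∂ν = ν.real A := by simp [hI, integral_indicator hA]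
  simp_rw [hexp]
  rw [integral_add h123 (integrable_const _), integral_add h12 h3,
    integral_add h1 h2, integral_const_mul, integral_const_mul, integral_div, integral_prod_mul,
    integral_fun_fst, integral_fun_snd, hμ, hν]
  simp

theorem intervalIntegral_intervalIntegral_eq_integral_prod {h : ℝ × ℝ → ℝ}
    (hh : Integrable h ((volume.restrict (Ioc (0:ℝ) 1)).prod (volume.restrict (Ioc (0:ℝ) 1)))) :
    ∫ x in (0:ℝ)..1, ∫ y in (0:ℝ)..1, h (x, y)
      = ∫ z, h z ∂((volume.restrict (Ioc (0:ℝ) 1)).prod (volume.restrict (Ioc (0:ℝ) 1))) := by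
  simp_rw [intervalIntegral.integral_of_le (zero_le_one' ℝ)]
  exact (integral_prod _ hh).symm

theorem measurableSet_box (x y : ℝ) : MeasurableSet (box x y) :=
  measurableSet_Icc.prod measurableSet_Icc

theorem measurableSet_setOf_mem_box :
    MeasurableSet {w : (ℝ × ℝ) × (ℝ × ℝ) | w.2 ∈ box w.1.1 w.1.2} := by
  simp only [box, mem_prod, mem_Icc, ofPred_and]
  refine .inter (.inter ?_ ?_) (.inter ?_ ?_) <;>
    exact measurableSet_le (by fun_prop) (by fun_prop)

theorem measurable_f1 {Ω : Set (ℝ × ℝ)} (hΩ : MeasurableSet Ω) :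
    Measurable fun z : ℝ × ℝ => f1 Ω z.1 z.2 :=
  (measurable_measure_prodMk_left
    ((measurable_snd hΩ).inter measurableSet_setOf_mem_box)).ennreal_toReal

theorem f1_mem_Icc {Ω : Set (ℝ × ℝ)} (hvol : volume Ω = 1 / 2) (x y : ℝ) :
    f1 Ω x y ∈ Icc (0:ℝ) 1 := by
  refine ⟨ENNReal.toReal_nonneg, ENNReal.toReal_le_of_le_ofReal zero_le_one ?_⟩
  calc volume (Ω ∩ box x y) ≤ volume Ω := measure_mono inter_subset_left
    _ ≤ ENNReal.ofReal 1 := by rw [hvol]; simp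

theorem volume_unitSq : volume unitSq = 1 := by
  rw [unitSq, Measure.volume_eq_prod, Measure.prod_prod]
  simp

theorem volume_unitSq_diff {Ω : Set (ℝ × ℝ)} (hΩ : MeasurableSet Ω) (hsub : Ω ⊆ unitSq)
    (hvol : volume Ω = 1 / 2) : volume (unitSq \ Ω) = 1 / 2 := by
  rw [measure_sdiff hsub hΩ.nullMeasurableSet (by simp [hvol]), volume_unitSq, hvol]
  simp

theorem isProbabilityMeasure_unif {S : Set (ℝ × ℝ)} (hS : volume S = 1 / 2) :
    IsProbabilityMeasure (unif S) :=
  ⟨by simp [unif, hS, ENNReal.mul_inv_cancel]⟩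

theorem unif_real_box {S : Set (ℝ × ℝ)} (hS : volume S = 1 / 2) (x y : ℝ) :
    (unif S).real (box x y) = 2 * f1 S x y := by
  simp [unif, hS, f1, measureReal_def, Measure.restrict_apply (measurableSet_box x y), inter_comm]

theorem f1_add_f1_diff {Ω : Set (ℝ × ℝ)} (hΩ : MeasurableSet Ω) {x y : ℝ}
    (hx : x ∈ Ioc (0:ℝ) 1) (hy : y ∈ Ioc (0:ℝ) 1) :
    f1 Ω x y + f1 (unitSq \ Ω) x y = x * y := by
  have hbox : box x y ⊆ unitSq :=
    prod_mono (Icc_subset_Icc_right hx.2) (Icc_subset_Icc_right hy.2)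
  have hvol : volume (box x y) = ENNReal.ofReal (x * y) := by
    rw [box, Measure.volume_eq_prod, Measure.prod_prod, ENNReal.ofReal_mul hx.1.le]
    simp
  have hfin : volume (box x y) ≠ ⊤ := by simp [hvol]
  have hdiff : (unitSq \ Ω) ∩ box x y = box x y \ Ω := by
    ext p
    exact ⟨fun h => ⟨h.2, h.1.2⟩, fun h => ⟨⟨hbox h.1, h.2⟩, h.1⟩⟩
  have hreal := measureReal_inter_add_sdiff (μ := volume) (s := box x y) hΩ hfin
  rw [f1, f1, hdiff, inter_comm]
  refine hreal.trans ?_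
  rw [measureReal_def, hvol, ENNReal.toReal_ofReal (mul_nonneg hx.1.le hy.1.le)]

theorem integrable_of_measurable_of_abs_le {α : Type*} [MeasurableSpace α] {μ : Measure α}
    [IsFiniteMeasure μ] {h : α → ℝ} (hm : Measurable h) {C : ℝ} (hC : ∀ᵐ a ∂μ, |h a| ≤ C) :
    Integrable h μ :=
  .of_bound hm.aestronglyMeasurable C hC

theorem ae_mem_Ioc_prod :
    ∀ᵐ z ∂((volume.restrict (Ioc (0:ℝ) 1)).prod (volume.restrict (Ioc (0:ℝ) 1))),
      z.1 ∈ Ioc (0:ℝ) 1 ∧ z.2 ∈ Ioc (0:ℝ) 1 := by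
  rw [Measure.prod_restrict]
  exact ae_restrict_mem (measurableSet_Ioc.prod measurableSet_Ioc)

theorem measurable_deviation :
    Measurable fun w : ((ℝ × ℝ) × (ℝ × ℝ)) × (ℝ × ℝ) =>
      |countIn w.1.1 w.1.2 w.2.1 w.2.2 / 2 - w.2.1 * w.2.2| ^ 2 := by
  have hind : Measurable fun w : (ℝ × ℝ) × (ℝ × ℝ) =>
      (box w.1.1 w.1.2).indicator (fun _ => (1:ℝ)) w.2 :=
    (measurable_const (a := (1:ℝ))).indicator measurableSet_setOf_mem_box
  have hfst := hind.comp (measurable_snd.prodMk measurable_fst.fst :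
    Measurable fun w : ((ℝ × ℝ) × (ℝ × ℝ)) × (ℝ × ℝ) => (w.2, w.1.1))
  have hsnd := hind.comp (measurable_snd.prodMk measurable_fst.snd :
    Measurable fun w : ((ℝ × ℝ) × (ℝ × ℝ)) × (ℝ × ℝ) => (w.2, w.1.2))
  have hcount : Measurable fun w : ((ℝ × ℝ) × (ℝ × ℝ)) × (ℝ × ℝ) =>
      countIn w.1.1 w.1.2 w.2.1 w.2.2 := hfst.add hsnd
  have habs := ((hcount.div_const 2).sub
    (measurable_snd.fst.mul measurable_snd.snd)).abs
  exact habs.pow_const 2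

theorem measurable_deviation_left (q : (ℝ × ℝ) × (ℝ × ℝ)) :
    Measurable fun z : ℝ × ℝ => |countIn q.1 q.2 z.1 z.2 / 2 - z.1 * z.2| ^ 2 := by
  have h := measurable_deviation.comp (measurable_prodMk_left (x := q))
  simpa only [Function.comp_def] using h

theorem deviation_le_one (p1 p2 : ℝ × ℝ) {x y : ℝ} (hx : x ∈ Ioc (0:ℝ) 1)
    (hy : y ∈ Ioc (0:ℝ) 1) : |(|countIn p1 p2 x y / 2 - x * y| ^ 2)| ≤ 1 := by
  have hbound : ∀ p, (box x y).indicator (fun _ => (1:ℝ)) p ∈ Icc (0:ℝ) 1 := fun p => by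
    by_cases h : p ∈ box x y <;> simp [h]
  have h1 := hbound p1
  have h2 := hbound p2
  have hxy : x * y ≤ 1 := mul_le_one₀ hx.2 hy.1.le hy.2
  have hxy0 : 0 ≤ x * y := mul_nonneg hx.1.le hy.1.le
  rw [abs_of_nonneg (by positivity)]
  refine pow_le_one₀ (abs_nonneg _) (abs_le.2 ?_)
  simp only [countIn]
  constructor <;> linarith [h1.1, h1.2, h2.1, h2.2]

/-- For `Ω` of measure `1/2`, the expected squared discrepancy is an affine function of
`∫∫ f1·(f1 − xy)` with slope `-2`. -/
theorem Djit_eq {Ω : Set (ℝ × ℝ)} (hΩ : MeasurableSet Ω) (hsub : Ω ⊆ unitSq)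
    (hvol : volume Ω = 1 / 2) :
    Djit Ω = (∫ z : ℝ × ℝ, (z.1 * z.2 / 2 - (z.1 * z.2) ^ 2)
        ∂((volume.restrict (Ioc (0:ℝ) 1)).prod (volume.restrict (Ioc (0:ℝ) 1))))
      - 2 * ∫ x in (0:ℝ)..1, ∫ y in (0:ℝ)..1, f1 Ω x y * (f1 Ω x y - x * y) := by
  set ν := (volume.restrict (Ioc (0:ℝ) 1)).prod (volume.restrict (Ioc (0:ℝ) 1))
  have hvol' := volume_unitSq_diff hΩ hsub hvol
  have := isProbabilityMeasure_unif hvol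
  have := isProbabilityMeasure_unif hvol'
  have : IsProbabilityMeasure (jitter Ω) := by unfold jitter; infer_instance
  have hF : Integrable (fun z : ℝ × ℝ => f1 Ω z.1 z.2 * (f1 Ω z.1 z.2 - z.1 * z.2)) ν := by
    refine integrable_of_measurable_of_abs_le (C := 1) ((measurable_f1 hΩ).mul
      ((measurable_f1 hΩ).sub (measurable_fst.mul measurable_snd))) ?_
    filter_upwards [ae_mem_Ioc_prod] with z hz
    have hf := f1_mem_Icc hvol z.1 z.2
    have hxy : z.1 * z.2 ≤ 1 := mul_le_one₀ hz.1.2 hz.2.1.le hz.2.2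
    have hxy0 : 0 ≤ z.1 * z.2 := mul_nonneg hz.1.1.le hz.2.1.le
    rw [abs_mul]
    refine mul_le_one₀ (abs_le.2 ?_) (abs_nonneg _) (abs_le.2 ?_) <;>
      constructor <;> linarith [hf.1, hf.2]
  have hC : Integrable (fun z : ℝ × ℝ => z.1 * z.2 / 2 - (z.1 * z.2) ^ 2) ν := by
    refine integrable_of_measurable_of_abs_le (C := 1) (by fun_prop) ?_
    filter_upwards [ae_mem_Ioc_prod] with z hz
    have hxy : z.1 * z.2 ≤ 1 := mul_le_one₀ hz.1.2 hz.2.1.le hz.2.2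
    have hxy0 : 0 ≤ z.1 * z.2 := mul_nonneg hz.1.1.le hz.2.1.le
    rw [abs_le]
    constructor <;> nlinarith
  have hdev : Integrable (fun w : ((ℝ × ℝ) × (ℝ × ℝ)) × (ℝ × ℝ) =>
      |countIn w.1.1 w.1.2 w.2.1 w.2.2 / 2 - w.2.1 * w.2.2| ^ 2) ((jitter Ω).prod ν) := by
    refine integrable_of_measurable_of_abs_le (C := 1) measurable_deviation ?_
    filter_upwards [Measure.quasiMeasurePreserving_snd.ae ae_mem_Ioc_prod] with w hw
    exact deviation_le_one _ _ hw.1 hw.2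
  have hL : ∀ q : (ℝ × ℝ) × (ℝ × ℝ),
      L2sq q.1 q.2 = ∫ z, |countIn q.1 q.2 z.1 z.2 / 2 - z.1 * z.2| ^ 2 ∂ν := fun q => by
    refine intervalIntegral_intervalIntegral_eq_integral_prod
      (h := fun z => |countIn q.1 q.2 z.1 z.2 / 2 - z.1 * z.2| ^ 2) ?_
    refine integrable_of_measurable_of_abs_le (C := 1) (measurable_deviation_left q) ?_
    filter_upwards [ae_mem_Ioc_prod] with z hz
    exact deviation_le_one _ _ hz.1 hz.2
  have hFint : ∫ x in (0:ℝ)..1, ∫ y in (0:ℝ)..1, f1 Ω x y * (f1 Ω x y - x * y)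
      = ∫ z, f1 Ω z.1 z.2 * (f1 Ω z.1 z.2 - z.1 * z.2) ∂ν :=
    intervalIntegral_intervalIntegral_eq_integral_prod hF
  rw [hFint, ← integral_const_mul,
    ← integral_sub hC (hF.const_mul 2), Djit]
  simp_rw [hL]
  rw [integral_integral_swap hdev]
  refine integral_congr_ae ?_
  filter_upwards [ae_mem_Ioc_prod] with z hz
  refine (integral_sq_indicator_average _ _ (measurableSet_box z.1 z.2) (z.1 * z.2)).trans ?_
  rw [unif_real_box hvol, unif_real_box hvol']
  rw [← f1_add_f1_diff hΩ hz.1 hz.2]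
  ring

/-- A measurable `Ω ⊆ [0,1]²` of measure `1/2` minimizes the
expected squared L2-discrepancy of the two-point jittered construction among all
measurable subsets of `[0,1]²` of measure `1/2` if and only if it maximizes the
functional `∫₀¹∫₀¹ f1·(f1 − xy)` among all such subsets. -/
theorem minimize_iff_maximize
    (Ω : Set (ℝ × ℝ)) (hΩ : MeasurableSet Ω) (hsub : Ω ⊆ unitSq)
    (hvol : volume Ω = 1/2) :
    (∀ Ω' : Set (ℝ × ℝ), MeasurableSet Ω' → Ω' ⊆ unitSq → volume Ω' = 1/2 →
        Djit Ω ≤ Djit Ω')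
      ↔ (∀ Ω' : Set (ℝ × ℝ), MeasurableSet Ω' → Ω' ⊆ unitSq → volume Ω' = 1/2 →
        (∫ x in (0:ℝ)..1, ∫ y in (0:ℝ)..1, f1 Ω' x y * (f1 Ω' x y - x * y))
          ≤ ∫ x in (0:ℝ)..1, ∫ y in (0:ℝ)..1, f1 Ω x y * (f1 Ω x y - x * y)) := by
  refine forall_congr' fun Ω' => forall_congr' fun hΩ' => forall_congr' fun hsub' =>
    forall_congr' fun hvol' => ?_
  rw [Djit_eq hΩ hsub hvol, Djit_eq hΩ' hsub' hvol']
  constructor <;> intro h <;> linarith
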